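/- arXiv:1907.07814 — 2 statements merged into one kernel-verified Lean document; each statement's English description precedes it below -/
import Mathlib

section
/- Let z_0 ≤ z_1 ≤ ⋯ ≤ z_{n−1} be positive integers and let x be an integer with x > z_{n−1}. Let t_n(x; w, x−Z) denote the n-th generalized Gončarov polynomial associated with the zeta-type enumerators a_n(·; w) and the grid x−Z = (x−z_0, x−z_1, …, x−z_{n−1}), evaluated at x (all integers being cast into R). Then t_n(x; w, x−Z) = Σ_{π ∈ Π_n} w(0̂, π) · PF_π(Z). (Theorem 3.5, second equality.) -/
open Finset

variable {R : Type*} [CommRing R] [Algebra ℚ R]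

/-- The zeta-type weight `w(0̂, π) = ∏_{B a block of π} w(|B|)`. -/
noncomputable def zetaWeight (w : ℕ → R) {n : ℕ} (π : Finpartition (univ : Finset (Fin n))) : R :=
  ∏ B ∈ π.parts, w B.card

/-- The zeta-type enumerator `a_n(x; w)`. -/
noncomputable def aEnum (w : ℕ → R) (n : ℕ) (x : R) : R :=
  if n = 0 then 1 else
    ∑ π : Finpartition (univ : Finset (Fin n)), zetaWeight w π * x ^ π.parts.card

/-- `f : Fin n → ℕ` is a `z⃗`-parking function: all entries are positive, and for each
`i < n` at least `i + 1` of the entries are `≤ z i`. -/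
def IsParking {n : ℕ} (z : ℕ → ℕ) (f : Fin n → ℕ) : Prop :=
  (∀ j, 1 ≤ f j) ∧
    ∀ i : Fin n, (i : ℕ) + 1 ≤ (univ.filter fun j => f j ≤ z (i : ℕ)).card

/-- `PF_π(Z)`: the number of labelings of the blocks of `π` by positive integers whose
associated sequence (constant on each block) is a `z⃗`-parking function. -/
noncomputable def PFcount {n : ℕ} (π : Finpartition (univ : Finset (Fin n))) (z : ℕ → ℕ) : ℕ :=
  Nat.card { f : Fin n → ℕ //
    (∀ B ∈ π.parts, ∀ i ∈ B, ∀ j ∈ B, f i = f j) ∧ IsParking z f }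

/-- The generalized Gončarov polynomials associated with the sequence `p` and the grid `Z`,
via the recurrence `t_n(x; Z) = p_n(x) - ∑_{i<n} C(n,i) p_{n-i}(z_i) t_i(x; Z)`
(with `t_0 = p_0 = 1`). -/
noncomputable def gonc {S : Type*} [CommRing S] (p : ℕ → S → S) (Z : ℕ → S) (n : ℕ) (x : S) : S :=
  p n x - ∑ i ∈ (Finset.range n).attach,
    (n.choose i.1 : S) * p (n - i.1) (Z i.1) * gonc p Z i.1 x
termination_by n
decreasing_by exact Finset.mem_range.mp i.2

/-- `f` is constant on each block of `π`. -/
def IsConstOnParts {α : Type*} [DecidableEq α] [Fintype α] (π : Finpartition (univ : Finset α))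
    (f : α → ℕ) : Prop :=
  ∀ B ∈ π.parts, ∀ i ∈ B, ∀ j ∈ B, f i = f j

section LabelWeight

variable {K : Type*} [CommRing K]

open Classical in
/-- The total weight of the partitions on whose blocks `f` is constant. -/
noncomputable def labelWeight (w : ℕ → K) {α : Type*} [DecidableEq α] [Fintype α] (f : α → ℕ) : K :=
  ∑ π : Finpartition (univ : Finset α) with IsConstOnParts π f, ∏ B ∈ π.parts, w #B

namespace Finpartition

variable {α β γ : Type*} [DecidableEq α] [Fintype α] [DecidableEq β] [Fintype β]
  [DecidableEq γ] [Fintype γ]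

/-- The partition of `α` glued from partitions of two complementary pieces. -/
def glue (e : β ⊕ γ ≃ α) (P : Finpartition (univ : Finset β)) (Q : Finpartition (univ : Finset γ)) :
    Finpartition (univ : Finset α) :=
  ofExistsUnique
    (P.parts.map (mapEmbedding (Function.Embedding.inl.trans e.toEmbedding)).toEmbedding ∪
      Q.parts.map (mapEmbedding (Function.Embedding.inr.trans e.toEmbedding)).toEmbedding)
    (fun _ _ => subset_univ _)
    (by
      intro a _
      obtain ⟨b | c, rfl⟩ := e.surjective a
      · obtain ⟨t, ⟨ht, hbt⟩, hu⟩ := P.existsUnique_mem (mem_univ b)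
        refine ⟨t.map (Function.Embedding.inl.trans e.toEmbedding), ⟨?_, ?_⟩, ?_⟩
        · simp only [mem_union, mem_map]; exact Or.inl ⟨t, ht, rfl⟩
        · simpa using hbt
        · rintro s ⟨hs, hbs⟩
          simp only [mem_union, mem_map] at hs
          obtain ⟨s, hs, rfl⟩ | ⟨s, hs, rfl⟩ := hs
          · rw [← hu s ⟨hs, by simpa using hbs⟩]; rfl
          · simp at hbs
      · obtain ⟨t, ⟨ht, hbt⟩, hu⟩ := Q.existsUnique_mem (mem_univ c)
        refine ⟨t.map (Function.Embedding.inr.trans e.toEmbedding), ⟨?_, ?_⟩, ?_⟩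
        · simp only [mem_union, mem_map]; exact Or.inr ⟨t, ht, rfl⟩
        · simpa using hbt
        · rintro s ⟨hs, hbs⟩
          simp only [mem_union, mem_map] at hs
          obtain ⟨s, hs, rfl⟩ | ⟨s, hs, rfl⟩ := hs
          · simp at hbs
          · rw [← hu s ⟨hs, by simpa using hbs⟩]; rfl)
    (by
      simp only [mem_union, mem_map, not_or, not_exists, not_and]
      refine ⟨fun t ht h => P.ne_empty ht ?_, fun t ht h => Q.ne_empty ht ?_⟩ <;>
      simpa using h)

lemma parts_glue (e : β ⊕ γ ≃ α) (P : Finpartition (univ : Finset β))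
    (Q : Finpartition (univ : Finset γ)) :
    (glue e P Q).parts =
      P.parts.map (mapEmbedding (Function.Embedding.inl.trans e.toEmbedding)).toEmbedding ∪
      Q.parts.map (mapEmbedding (Function.Embedding.inr.trans e.toEmbedding)).toEmbedding :=
  rfl

/-- The partition of `β` formed by the blocks of `π` lying in the image of `β`, when these cover
that image. -/
def pull (e : β ↪ α) (π : Finpartition (univ : Finset α))
    (h : ∀ b, ∀ a ∈ π.part (e b), a ∈ Set.range e) : Finpartition (univ : Finset β) :=
  ofExistsUnique {B | B.map e ∈ π.parts} (fun _ _ => subset_univ _)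
    (by
      intro b _
      have hmap : (univ.filter fun b' => e b' ∈ π.part (e b)).map e = π.part (e b) := by
        ext a
        simp only [mem_map, mem_filter, mem_univ, true_and]
        refine ⟨?_, fun ha => ?_⟩
        · rintro ⟨b', hb', rfl⟩; exact hb'
        · obtain ⟨b', rfl⟩ := h b a ha
          exact ⟨b', ha, rfl⟩
      refine ⟨univ.filter fun b' => e b' ∈ π.part (e b), ⟨?_, ?_⟩, ?_⟩
      · rw [mem_filter, hmap]
        exact ⟨mem_univ _, π.part_mem.2 (mem_univ _)⟩
      · simp [π.mem_part (mem_univ (e b))]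
      · rintro s ⟨hs, hbs⟩
        apply map_injective e
        rw [hmap]
        exact (π.part_eq_of_mem (mem_filter.1 hs).2 (mem_map_of_mem e hbs)).symm)
    (by simp)

lemma mem_parts_pull (e : β ↪ α) (π : Finpartition (univ : Finset α))
    (h : ∀ b, ∀ a ∈ π.part (e b), a ∈ Set.range e) (B : Finset β) :
    B ∈ (pull e π h).parts ↔ B.map e ∈ π.parts := by
  simp [pull, ofExistsUnique]

lemma map_inl_mem_parts_glue (e : β ⊕ γ ≃ α) (P : Finpartition (univ : Finset β))
    (Q : Finpartition (univ : Finset γ)) (B : Finset β) :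
    B.map (Function.Embedding.inl.trans e.toEmbedding) ∈ (glue e P Q).parts ↔ B ∈ P.parts := by
  rw [parts_glue, mem_union, mem_map, mem_map]
  refine ⟨?_, fun h => Or.inl ⟨B, h, rfl⟩⟩
  rintro (⟨s, hs, h⟩ | ⟨s, hs, h⟩)
  · rwa [← map_injective _ h]
  · obtain ⟨c, hc⟩ := Q.nonempty_of_mem_parts hs
    have : e (.inr c) ∈ s.map (Function.Embedding.inr.trans e.toEmbedding) := by simpa using hc
    rw [show s.map (Function.Embedding.inr.trans e.toEmbedding) = _ from h] at this
    simp at this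

lemma map_inr_mem_parts_glue (e : β ⊕ γ ≃ α) (P : Finpartition (univ : Finset β))
    (Q : Finpartition (univ : Finset γ)) (B : Finset γ) :
    B.map (Function.Embedding.inr.trans e.toEmbedding) ∈ (glue e P Q).parts ↔ B ∈ Q.parts := by
  rw [parts_glue, mem_union, mem_map, mem_map]
  refine ⟨?_, fun h => Or.inr ⟨B, h, rfl⟩⟩
  rintro (⟨s, hs, h⟩ | ⟨s, hs, h⟩)
  · obtain ⟨c, hc⟩ := P.nonempty_of_mem_parts hs
    have : e (.inl c) ∈ s.map (Function.Embedding.inl.trans e.toEmbedding) := by simpa using hc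
    rw [show s.map (Function.Embedding.inl.trans e.toEmbedding) = _ from h] at this
    simp at this
  · rwa [← map_injective _ h]

lemma prod_parts_glue {M : Type*} [CommMonoid M] (e : β ⊕ γ ≃ α)
    (P : Finpartition (univ : Finset β)) (Q : Finpartition (univ : Finset γ)) (w : ℕ → M) :
    ∏ B ∈ (glue e P Q).parts, w #B = (∏ B ∈ P.parts, w #B) * ∏ B ∈ Q.parts, w #B := by
  rw [parts_glue, prod_union, prod_map, prod_map]
  · simp
  · rw [disjoint_left]
    intro A hA hA'
    obtain ⟨B, -, rfl⟩ := mem_map.1 hA'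
    obtain ⟨C, hC, h⟩ := mem_map.1 hA
    obtain ⟨c, hc⟩ := P.nonempty_of_mem_parts hC
    have : e (.inl c) ∈ C.map (Function.Embedding.inl.trans e.toEmbedding) := by simpa using hc
    rw [show C.map (Function.Embedding.inl.trans e.toEmbedding) = _ from h] at this
    simp at this

lemma isConstOnParts_glue (e : β ⊕ γ ≃ α) (P : Finpartition (univ : Finset β))
    (Q : Finpartition (univ : Finset γ)) (f : α → ℕ) :
    IsConstOnParts (glue e P Q) f ↔
      IsConstOnParts P (fun b => f (e (.inl b))) ∧ IsConstOnParts Q (fun c => f (e (.inr c))) := by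
  simp only [IsConstOnParts, parts_glue, forall_mem_union, forall_mem_map]
  simp [mapEmbedding]

lemma exists_glue_eq (e : β ⊕ γ ≃ α) {f : α → ℕ}
    (hsep : ∀ b c, f (e (.inl b)) ≠ f (e (.inr c))) {π : Finpartition (univ : Finset α)}
    (hπ : IsConstOnParts π f) : ∃ P Q, glue e P Q = π := by
  have hf : ∀ a, ∀ a' ∈ π.part a, f a' = f a := fun a a' ha' =>
    hπ _ (π.part_mem.2 (mem_univ a)) _ ha' _ (π.mem_part (mem_univ a))
  have hl : ∀ b, ∀ a ∈ π.part (Function.Embedding.inl.trans e.toEmbedding b),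
      a ∈ Set.range (Function.Embedding.inl.trans e.toEmbedding) := by
    intro b a ha
    obtain ⟨b' | c, rfl⟩ := e.surjective a
    · exact ⟨b', rfl⟩
    · exact absurd (hf _ _ ha).symm (hsep b c)
  have hr : ∀ c, ∀ a ∈ π.part (Function.Embedding.inr.trans e.toEmbedding c),
      a ∈ Set.range (Function.Embedding.inr.trans e.toEmbedding) := by
    intro c a ha
    obtain ⟨b | c', rfl⟩ := e.surjective a
    · exact absurd (hf _ _ ha) (hsep b c)
    · exact ⟨c', rfl⟩
  refine ⟨pull _ π hl, pull _ π hr, ?_⟩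
  refine Finpartition.ext (Finset.ext fun A => ⟨fun hA => ?_, fun hA => ?_⟩)
  · rw [parts_glue, mem_union, mem_map, mem_map] at hA
    obtain ⟨B, hB, rfl⟩ | ⟨B, hB, rfl⟩ := hA <;> exact (mem_parts_pull _ π _ B).1 hB
  · obtain ⟨a, ha⟩ := π.nonempty_of_mem_parts hA
    obtain rfl := π.part_eq_of_mem hA ha
    obtain ⟨b | c, rfl⟩ := e.surjective a
    · have h := (pull _ π hl).part_mem.2 (mem_univ b)
      convert (map_inl_mem_parts_glue e _ (pull _ π hr) _).2 h using 1
      exact π.part_eq_of_mem ((mem_parts_pull _ π hl _).1 h)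
        (mem_map_of_mem _ ((pull _ π hl).mem_part (mem_univ b)))
    · have h := (pull _ π hr).part_mem.2 (mem_univ c)
      convert (map_inr_mem_parts_glue e (pull _ π hl) _ _).2 h using 1
      exact π.part_eq_of_mem ((mem_parts_pull _ π hr _).1 h)
        (mem_map_of_mem _ ((pull _ π hr).mem_part (mem_univ c)))

open Classical in
lemma card_isConstOnParts (π : Finpartition (univ : Finset α)) (s : Finset ℕ) :
    #{f ∈ Fintype.piFinset fun _ : α => s | IsConstOnParts π f} = #s ^ #π.parts := by
  have hcard : #(Fintype.piFinset fun _ : π.parts => s) = #s ^ #π.parts := by simp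
  rw [← hcard]
  symm
  refine card_bij (fun g _ a => g ⟨π.part a, π.part_mem.2 (mem_univ a)⟩) ?_ ?_ ?_
  · intro g hg
    rw [mem_filter, Fintype.mem_piFinset]
    refine ⟨fun a => Fintype.mem_piFinset.1 hg _, fun B hB i hi j hj => ?_⟩
    simp only [π.part_eq_of_mem hB hi, π.part_eq_of_mem hB hj]
  · intro g _ g' _ h
    funext ⟨B, hB⟩
    obtain ⟨a, ha⟩ := π.nonempty_of_mem_parts hB
    obtain rfl := π.part_eq_of_mem hB ha
    exact congrFun h a
  · intro f hf
    rw [mem_filter, Fintype.mem_piFinset] at hf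
    refine ⟨fun B => f (π.nonempty_of_mem_parts B.2).choose,
      Fintype.mem_piFinset.2 fun B => hf.1 _, funext fun a => ?_⟩
    have hB := π.part_mem.2 (mem_univ a)
    exact hf.2 _ hB _ (π.nonempty_of_mem_parts hB).choose_spec _ (π.mem_part (mem_univ a))

end Finpartition

lemma labelWeight_eq_mul (w : ℕ → K) {α β γ : Type*} [DecidableEq α] [Fintype α] [DecidableEq β]
    [Fintype β] [DecidableEq γ] [Fintype γ] (e : β ⊕ γ ≃ α) (f : α → ℕ)
    (hsep : ∀ b c, f (e (.inl b)) ≠ f (e (.inr c))) :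
    labelWeight w f =
      labelWeight w (fun b => f (e (.inl b))) * labelWeight w (fun c => f (e (.inr c))) := by
  classical
  simp only [labelWeight]
  rw [sum_mul_sum, ← sum_product']
  symm
  refine sum_bij (fun p _ => Finpartition.glue e p.1 p.2) ?_ ?_ ?_ ?_
  · rintro ⟨P, Q⟩ h
    simpa [Finpartition.isConstOnParts_glue] using h
  · rintro ⟨P, Q⟩ - ⟨P', Q'⟩ - h
    have hP : P = P' := Finpartition.ext <| Finset.ext fun B => by
      rw [← Finpartition.map_inl_mem_parts_glue e P Q, h, Finpartition.map_inl_mem_parts_glue]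
    have hQ : Q = Q' := Finpartition.ext <| Finset.ext fun B => by
      rw [← Finpartition.map_inr_mem_parts_glue e P Q, h, Finpartition.map_inr_mem_parts_glue]
    rw [hP, hQ]
  · intro π hπ
    have hc := (mem_filter.1 hπ).2
    obtain ⟨P, Q, rfl⟩ := Finpartition.exists_glue_eq e hsep hc
    exact ⟨(P, Q), by simpa [Finpartition.isConstOnParts_glue] using hc, rfl⟩
  · rintro ⟨P, Q⟩ -
    exact (Finpartition.prod_parts_glue e P Q w).symm

open Classical in
lemma sum_labelWeight (w : ℕ → K) {n : ℕ} (s : Finset (Fin n → ℕ)) :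
    ∑ f ∈ s, labelWeight w f = ∑ π : Finpartition (univ : Finset (Fin n)),
      zetaWeight w π * (#{f ∈ s | IsConstOnParts π f} : K) := by
  simp only [labelWeight, sum_filter]
  rw [sum_comm]
  refine sum_congr rfl fun π _ => ?_
  rw [← sum_filter, sum_const, nsmul_eq_mul, mul_comm]
  rfl

lemma aEnum_eq_sum (w : ℕ → K) (n : ℕ) (x : K) :
    aEnum w n x = ∑ π : Finpartition (univ : Finset (Fin n)), zetaWeight w π * x ^ #π.parts := by
  rw [aEnum]
  split_ifs with h
  · subst h
    have hu : ∀ π : Finpartition (univ : Finset (Fin 0)), π.parts = ∅ := fun π =>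
      Finpartition.parts_eq_empty_iff.2 (by simp)
    have : Unique (Finpartition (univ : Finset (Fin 0))) :=
      inferInstanceAs (Unique (Finpartition (⊥ : Finset (Fin 0))))
    rw [Fintype.sum_unique]
    simp [zetaWeight, hu]
  · rfl

lemma sum_labelWeight_piFinset (w : ℕ → K) (n : ℕ) (s : Finset ℕ) :
    ∑ f ∈ Fintype.piFinset (fun _ : Fin n => s), labelWeight w f = aEnum w n (#s : K) := by
  classical
  rw [sum_labelWeight, aEnum_eq_sum]
  refine sum_congr rfl fun π _ => ?_
  rw [Finpartition.card_isConstOnParts, Nat.cast_pow]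

lemma IsParking.le {n : ℕ} {z : ℕ → ℕ} {f : Fin n → ℕ} (hf : IsParking z f) (j : Fin n) :
    f j ≤ z (n - 1) := by
  have hn := j.pos
  have h := hf.2 ⟨n - 1, by omega⟩
  simp only [Nat.sub_add_cancel hn] at h
  have : (univ.filter fun j => f j ≤ z (n - 1)) = univ :=
    eq_univ_of_card _ (le_antisymm (card_le_univ _) (by simpa using h))
  exact filter_eq_self.1 this j (mem_univ j)

open Classical in
/-- The weighted count of `z⃗`-parking functions of length `n` with entries at most `X`. -/
noncomputable def parkingSum (w : ℕ → K) (z : ℕ → ℕ) (X n : ℕ) : K :=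
  ∑ f ∈ Fintype.piFinset (fun _ : Fin n => Icc 1 X) with IsParking z f, labelWeight w f

lemma parkingSum_eq (w : ℕ → K) (z : ℕ → ℕ) (X n : ℕ) (hX : ∀ i < n, z i ≤ X) :
    parkingSum w z X n =
      ∑ π : Finpartition (univ : Finset (Fin n)), zetaWeight w π * (PFcount π z : K) := by
  classical
  rw [parkingSum, sum_labelWeight]
  refine sum_congr rfl fun π _ => ?_
  rw [PFcount, Nat.subtype_card
    {f ∈ {f ∈ Fintype.piFinset (fun _ : Fin n => Icc 1 X) | IsParking z f} | IsConstOnParts π f}]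
  intro f
  simp only [mem_filter, Fintype.mem_piFinset, mem_Icc]
  refine ⟨fun h => ⟨h.2, h.1.2⟩, fun h => ⟨⟨fun j => ⟨h.2.1 j, ?_⟩, h.2⟩, h.1⟩⟩
  have hn := j.pos
  exact (h.2.le j).trans (hX _ (by omega))

/-- `S` indexes an initial parking segment of `f`: the entries indexed by `S` satisfy the parking
inequalities, and all the other entries exceed `z |S|`. -/
def IsParkingSegment {n : ℕ} (z : ℕ → ℕ) (f : Fin n → ℕ) (S : Finset (Fin n)) : Prop :=
  (∀ i < #S, i + 1 ≤ #{k ∈ S | f k ≤ z i}) ∧ ∀ k ∉ S, z #S < f k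

namespace IsParkingSegment

variable {n : ℕ} {z : ℕ → ℕ} {f : Fin n → ℕ} {S T : Finset (Fin n)}

lemma le_of_mem (h : IsParkingSegment z f S) {k : Fin n} (hk : k ∈ S) : f k ≤ z (#S - 1) := by
  have hpos : 0 < #S := card_pos.2 ⟨k, hk⟩
  have h1 := h.1 (#S - 1) (by omega)
  have heq : {k ∈ S | f k ≤ z (#S - 1)} = S :=
    eq_of_subset_of_card_le (filter_subset _ _) (by omega)
  exact (mem_filter.1 (heq.symm ▸ hk : k ∈ {k ∈ S | f k ≤ z (#S - 1)})).2

lemma mem_iff (hmono : ∀ i j, i ≤ j → j < n → z i ≤ z j) (h : IsParkingSegment z f S)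
    (hS : #S < n) (k : Fin n) : k ∈ S ↔ f k ≤ z #S :=
  ⟨fun hk => (h.le_of_mem hk).trans (hmono _ _ (Nat.sub_le _ _) hS),
    fun hk => by_contra fun hk' => absurd (h.2 k hk') (by omega)⟩

lemma card_le (h : IsParkingSegment z f S) (h' : IsParkingSegment z f T) : #T ≤ #S := by
  by_contra! hlt
  have h1 := h'.1 _ hlt
  have h2 : #{k ∈ T | f k ≤ z #S} ≤ #S := card_le_card fun k hk =>
    by_contra fun hk' => absurd (h.2 k hk') (by have := (mem_filter.1 hk).2; omega)
  omega

lemma unique (hmono : ∀ i j, i ≤ j → j < n → z i ≤ z j) (h : IsParkingSegment z f S)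
    (h' : IsParkingSegment z f T) : S = T := by
  have hc : #S = #T := le_antisymm (h'.card_le h) (h.card_le h')
  rcases (card_le_univ S).lt_or_eq with hS | hS
  · rw [Fintype.card_fin] at hS
    ext k
    rw [h.mem_iff hmono hS, h'.mem_iff hmono (hc ▸ hS), hc]
  · rw [eq_univ_of_card S hS, eq_univ_of_card T (hc ▸ hS)]

end IsParkingSegment

lemma exists_isParkingSegment {n : ℕ} {z : ℕ → ℕ} (hmono : ∀ i j, i ≤ j → j < n → z i ≤ z j)
    (f : Fin n → ℕ) : ∃ S, IsParkingSegment z f S := by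
  classical
  have hex : ∃ i, n ≤ i ∨ #{k | f k ≤ z i} ≤ i := ⟨n, .inl le_rfl⟩
  have hmin : ∀ i < Nat.find hex, i < n ∧ i + 1 ≤ #{k | f k ≤ z i} := fun i hi => by
    have := Nat.find_min hex hi
    omega
  by_cases hn : n ≤ Nat.find hex
  · refine ⟨univ, fun i hi => (hmin i ?_).2, fun k hk => absurd (mem_univ k) hk⟩
    rw [card_univ, Fintype.card_fin] at hi
    omega
  · have hle := (Nat.find_spec hex).resolve_left hn
    set i := Nat.find hex
    have hsub : ∀ j < i, ({k | f k ≤ z j} : Finset (Fin n)) ⊆ ({k | f k ≤ z i} : Finset (Fin n)) :=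
      fun j hj => monotone_filter_right _ fun k _ hk =>
        le_trans hk (hmono j i hj.le (by omega))
    have hcard : #{k | f k ≤ z i} = i := by
      refine le_antisymm hle ?_
      rcases Nat.eq_zero_or_pos i with h0 | hpos
      · omega
      · have h1 := (hmin (i - 1) (by omega)).2
        have h2 := card_le_card (hsub (i - 1) (by omega))
        omega
    refine ⟨univ.filter fun k => f k ≤ z i, ?_, ?_⟩
    · rw [hcard]
      intro j hj
      rw [filter_filter]
      refine (hmin j hj).2.trans (card_le_card fun k hk => ?_)
      have := hsub j hj hk
      simp only [mem_filter, mem_univ, true_and] at hk this ⊢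
      exact ⟨this, hk⟩
    · rw [hcard]
      intro k hk
      simpa using hk

open Classical in
lemma sum_labelWeight_isParkingSegment (w : ℕ → K) {n m l X : ℕ} {z : ℕ → ℕ}
    (hmono : ∀ i j, i ≤ j → j < n → z i ≤ z j) {S : Finset (Fin n)} (hm : #S = m) (hl : #Sᶜ = l) :
    ∑ f ∈ Fintype.piFinset (fun _ : Fin n => Icc 1 X) with IsParkingSegment z f S,
        labelWeight w f =
      parkingSum w z X m * aEnum w l ((X - z m : ℕ) : K) := by
  have hml : m + l = n := by
    rw [← hm, ← hl, card_add_card_compl, Fintype.card_fin]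
  let e := finSumEquivOfFinset hm hl
  have hinl : ∀ b, e (.inl b) ∈ S := fun b => by
    simp [e, finSumEquivOfFinset_inl]
  have hinr : ∀ c, e (.inr c) ∉ S := fun c => by
    rw [finSumEquivOfFinset_inr]
    exact mem_compl.1 (orderEmbOfFin_mem Sᶜ hl c)
  have hcard : ∀ (f : Fin n → ℕ) (a : ℕ),
      #{k ∈ S | f k ≤ a} = #{b : Fin m | f (e (.inl b)) ≤ a} := fun f a => by
    symm
    refine card_bij (fun b _ => e (.inl b)) ?_ ?_ ?_
    · intro b hb
      exact mem_filter.2 ⟨hinl b, (mem_filter.1 hb).2⟩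
    · intro b _ b' _ h
      simpa using h
    · intro k hk
      rw [mem_filter] at hk
      obtain ⟨b | c, rfl⟩ := e.surjective k
      · exact ⟨b, by simpa using hk.2, rfl⟩
      · exact absurd hk.1 (hinr c)
  have hiff : ∀ f : Fin n → ℕ, f ∈ Fintype.piFinset (fun _ : Fin n => Icc 1 X) ∧
      IsParkingSegment z f S ↔
      ((fun b => f (e (.inl b))) ∈ Fintype.piFinset (fun _ : Fin m => Icc 1 X) ∧
        IsParking z fun b => f (e (.inl b))) ∧
      (fun c => f (e (.inr c))) ∈ Fintype.piFinset (fun _ : Fin l => Ioc (z m) X) := fun f => by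
    simp only [Fintype.mem_piFinset, mem_Icc, mem_Ioc, IsParkingSegment, IsParking, hcard, hm]
    constructor
    · rintro ⟨h1, h2, h3⟩
      exact ⟨⟨fun b => h1 _, fun b => (h1 _).1, fun i => h2 i i.2⟩,
        fun c => ⟨h3 _ (hinr c), (h1 _).2⟩⟩
    · rintro ⟨⟨h1, -, h2⟩, h3⟩
      refine ⟨fun k => ?_, fun i hi => h2 ⟨i, hi⟩, fun k hk => ?_⟩
      · obtain ⟨b | c, rfl⟩ := e.surjective k
        · exact h1 b
        · exact ⟨Nat.one_le_iff_ne_zero.2 (Nat.ne_zero_of_lt (h3 c).1), (h3 c).2⟩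
      · obtain ⟨b | c, rfl⟩ := e.surjective k
        · exact absurd (hinl b) hk
        · exact (h3 c).1
  rw [← Nat.card_Ioc, ← sum_labelWeight_piFinset, parkingSum, sum_mul_sum, ← sum_product']
  refine sum_nbij' (fun f => (fun b => f (e (.inl b)), fun c => f (e (.inr c))))
    (fun p => Sum.elim p.1 p.2 ∘ e.symm) ?_ ?_ ?_ ?_ ?_
  · intro f hf
    simpa only [mem_product, mem_filter] using (hiff f).1 (mem_filter.1 hf)
  · intro p hp
    rw [mem_filter, hiff]
    simpa only [mem_product, mem_filter, Function.comp_apply, Equiv.symm_apply_apply,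
      Sum.elim_inl, Sum.elim_inr] using hp
  · intro f _
    funext k
    obtain ⟨b | c, rfl⟩ := e.surjective k <;> simp
  · intro p _
    simp
  · intro f hf
    refine labelWeight_eq_mul w e f fun b c => ne_of_lt ?_
    have hseg := (mem_filter.1 hf).2
    have hn := c.pos
    exact ((hseg.mem_iff hmono (by omega) _).1 (hinl b)).trans_lt (hseg.2 _ (hinr c))

/-- Splitting every function into its maximal parking segment and the remaining large entries. -/
lemma aEnum_eq_sum_parkingSum (w : ℕ → K) {n X : ℕ} {z : ℕ → ℕ}
    (hmono : ∀ i j, i ≤ j → j < n → z i ≤ z j) :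
    aEnum w n (X : K) = ∑ m ∈ range (n + 1),
      (n.choose m : K) * (parkingSum w z X m * aEnum w (n - m) ((X - z m : ℕ) : K)) := by
  classical
  have h1 : aEnum w n (X : K) = ∑ f ∈ Fintype.piFinset (fun _ : Fin n => Icc 1 X),
      labelWeight w f := by
    rw [sum_labelWeight_piFinset, Nat.card_Icc, Nat.add_sub_cancel]
  have h2 : ∀ f : Fin n → ℕ, labelWeight w f = ∑ S ∈ (univ : Finset (Fin n)).powerset,
      if IsParkingSegment z f S then labelWeight w f else 0 := fun f => by
    obtain ⟨T, hT⟩ := exists_isParkingSegment hmono f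
    rw [sum_eq_single T, if_pos hT]
    · exact fun S _ hS => if_neg fun h => hS (h.unique hmono hT)
    · simp
  rw [h1, sum_congr rfl fun f _ => h2 f, sum_comm]
  have h3 := sum_powerset_apply_card
    (fun m => parkingSum w z X m * aEnum w (n - m) ((X - z m : ℕ) : K))
    (x := (univ : Finset (Fin n)))
  simp only [card_univ, Fintype.card_fin, nsmul_eq_mul] at h3
  rw [← h3]
  refine sum_congr rfl fun S _ => ?_
  rw [← sum_filter]
  exact sum_labelWeight_isParkingSegment w hmono rfl (by rw [card_compl, Fintype.card_fin])

lemma gonc_eq_parkingSum (w : ℕ → K) (z : ℕ → ℕ) (X n : ℕ)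
    (hmono : ∀ i j, i ≤ j → j < n → z i ≤ z j) (hX : ∀ i < n, z i ≤ X) :
    gonc (aEnum w) (fun i => (X : K) - (z i : K)) n (X : K) = parkingSum w z X n := by
  induction n using Nat.strong_induction_on with
  | _ n ih =>
    rw [gonc, aEnum_eq_sum_parkingSum w hmono, sum_range_succ, sub_eq_iff_eq_add,
      sum_attach (range n) fun i => (n.choose i : K) * aEnum w (n - i) ((X : K) - (z i : K)) *
        gonc (aEnum w) (fun i => (X : K) - (z i : K)) i (X : K), add_comm]
    congr 1
    · simp [aEnum]
    · refine sum_congr rfl fun i hi => ?_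
      have hi := mem_range.1 hi
      rw [ih i hi (fun a b hab hb => hmono a b hab (hb.trans hi)) fun a ha => hX a (ha.trans hi),
        Nat.cast_sub (hX i hi)]
      ring

end LabelWeight

/-- Theorem 3.5 (second equality): for positive integers `z_0 ≤ ⋯ ≤ z_{n-1}` and an
integer `x > z_{n-1}`, the Gončarov polynomial for the grid `x - Z`, evaluated at `x`,
equals `∑_{π ∈ Π_n} w(0̂, π) PF_π(Z)`. -/
theorem goncarov_partition_lattice (w : ℕ → R) (hw : w 1 = 1) (n : ℕ) (z : ℕ → ℕ)
    (hpos : ∀ i < n, 0 < z i) (hmono : ∀ i j, i ≤ j → j < n → z i ≤ z j)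
    (x : ℤ) (hx : ∀ i < n, (z i : ℤ) < x) :
    gonc (aEnum w) (fun i => (x : R) - (z i : R)) n (x : R)
      = ∑ π : Finpartition (univ : Finset (Fin n)), zetaWeight w π * (PFcount π z : R) := by
  rcases Nat.eq_zero_or_pos n with rfl | hn
  · rw [← parkingSum_eq w z 0 0 (by simp), ← gonc_eq_parkingSum w z 0 0 (by simp) (by simp)]
    rw [gonc, gonc]
    simp [aEnum]
  · lift x to ℕ using (Int.natCast_nonneg (z 0)).trans (hx 0 hn).le
    have hX : ∀ i < n, z i ≤ x := fun i hi => by exact_mod_cast (hx i hi).le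
    rw [← parkingSum_eq w z x n hX, ← gonc_eq_parkingSum w z x n hmono hX]
    simp
end

section
/- Let d : ℕ → ℕ, let y_1, y_2, … ∈ R, and let z_0 ≤ z_1 ≤ ⋯ ≤ z_{n−1} be positive integers with x an integer > z_{n−1}. Let t_n(·; y, F, Z) be the generalized Gončarov polynomials defined by the recursion t_0 = 1 and t_n(x; y, F, Z) = h_n(x;y) − Σ_{i=0}^{n−1} C(n,i) h_{n−i}(z_i;y) t_i(x; y, F, Z). Then t_n(0; y, F, −Z) = t_n(x; y, F, x−Z) = Σ_{π ∈ Π_n} ( ∏_{B a block of π} d_{|B|} y_{|B|} ) · PF_π(Z), the sum over hands H of weight n of type(H) times the number of card-labelings of H that are z⃗-parking functions. (Theorem 4.4.) -/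
open Finset

variable {R : Type*} [CommRing R] [Algebra ℚ R]

/-- The type enumerator of the exponential family with deck sizes `d` and type variables
`y`:  `h_0 = 1` and `h_n(x; y) = ∑_{π ∈ Π_n} (∏_{B a block of π} d_{|B|} y_{|B|}) x^{|π|}`
for `n ≥ 1` (a hand of weight `n` is a partition `π` together with one of `d_{|B|}`
pictures on each block `B`, and its type is `∏_B y_{|B|}`). -/
noncomputable def hEnum (d : ℕ → ℕ) (y : ℕ → R) (n : ℕ) (x : R) : R :=
  if n = 0 then 1 else
    ∑ π : Finpartition (univ : Finset (Fin n)),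
      (∏ B ∈ π.parts, (d B.card : R) * y B.card) * x ^ π.parts.card

section GoncarovRecurrence

variable {S : Type*} [CommRing S]

theorem gonc_def (p : ℕ → S → S) (Z : ℕ → S) (n : ℕ) (x : S) :
    gonc p Z n x = p n x - ∑ i ∈ range n, (n.choose i : S) * p (n - i) (Z i) * gonc p Z i x := by
  rw [gonc, sum_attach (range n) fun i => (n.choose i : S) * p (n - i) (Z i) * gonc p Z i x]

theorem sum_choose_mul_gonc {p : ℕ → S → S} (hp : ∀ x, p 0 x = 1) (Z : ℕ → S) (n : ℕ) (x : S) :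
    ∑ i ∈ range (n + 1), (n.choose i : S) * p (n - i) (Z i) * gonc p Z i x = p n x := by
  rw [sum_range_succ, gonc_def p Z n x]
  simp [hp]

theorem gonc_congr (p : ℕ → S → S) {Z Z' : ℕ → S} (x : S) {n : ℕ} (h : ∀ i < n, Z i = Z' i) :
    gonc p Z n x = gonc p Z' n x := by
  induction n using Nat.strong_induction_on with
  | _ n ih =>
    rw [gonc_def, gonc_def]
    congr 1
    refine sum_congr rfl fun i hi => ?_
    have hi := mem_range.1 hi
    rw [h i hi, ih i hi fun j hj => h j (hj.trans hi)]

/-- The Gončarov polynomials are the only solution of their linear recurrence. -/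
theorem eq_gonc_of_sum_eq {p : ℕ → S → S} (hp : ∀ x, p 0 x = 1) (Z : ℕ → S) (x : S) {a : ℕ → S}
    (h : ∀ n, ∑ i ∈ range (n + 1), (n.choose i : S) * p (n - i) (Z i) * a i = p n x) (n : ℕ) :
    a n = gonc p Z n x := by
  induction n using Nat.strong_induction_on with
  | _ n ih =>
    have h₁ := h n
    rw [sum_range_succ] at h₁
    rw [gonc_def, ← h₁, sum_congr rfl fun i hi => by rw [ih i (mem_range.1 hi)]]
    simp [hp]

/-- Gončarov polynomials of a sequence of binomial type are invariant under translation. -/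
theorem gonc_zero_neg_eq_gonc_sub {p : ℕ → S → S} (hp : ∀ x, p 0 x = 1)
    (hp₀ : ∀ n, n ≠ 0 → p n 0 = 0)
    (hadd : ∀ n x y, p n (x + y) = ∑ k ∈ range (n + 1), (n.choose k : S) * p k x * p (n - k) y)
    (Z : ℕ → S) (x : S) (n : ℕ) :
    gonc p (fun i => -Z i) n 0 = gonc p (fun i => x - Z i) n x := by
  refine eq_gonc_of_sum_eq hp _ x (a := fun n => gonc p (fun i => -Z i) n 0) (fun n => ?_) n
  set a := fun n => gonc p (fun i => -Z i) n 0
  calc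
    _ = ∑ i ∈ range (n + 1), ∑ k ∈ range (n - i + 1),
          (n.choose i : S) * ((n - i).choose k * p k x * p (n - i - k) (-Z i)) * a i := by
      refine sum_congr rfl fun i _ => ?_
      rw [sub_eq_add_neg, hadd, mul_sum, sum_mul]
    _ = ∑ k ∈ range (n + 1), ∑ i ∈ range (n - k + 1),
          (n.choose i : S) * ((n - i).choose k * p k x * p (n - i - k) (-Z i)) * a i :=
      sum_comm' fun i k => by simp only [mem_range]; omega
    _ = ∑ k ∈ range (n + 1), (n.choose k : S) * p k x * p (n - k) 0 := by
      refine sum_congr rfl fun k hk => ?_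
      rw [← sum_choose_mul_gonc hp (fun i => -Z i) (n - k) 0, mul_sum]
      refine sum_congr rfl fun i hi => ?_
      have hk := mem_range.1 hk
      have hi := mem_range.1 hi
      have hc : n.choose i * (n - i).choose k = n.choose k * (n - k).choose i := by
        have h₁ := Nat.choose_mul (n := n) (k := i + k) (s := i) (by omega)
        have h₂ := Nat.choose_mul (n := n) (k := i + k) (s := k) (by omega)
        rw [Nat.add_sub_cancel_left] at h₁
        rw [Nat.add_sub_cancel] at h₂
        rw [← h₁, ← h₂, Nat.choose_symm_add]
      have hc' : (n.choose i : S) * (n - i).choose k = n.choose k * (n - k).choose i := by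
        rw [← Nat.cast_mul, hc, Nat.cast_mul]
      rw [show n - k - i = n - i - k by omega]
      linear_combination (p k x * p (n - i - k) (-Z i) * a i) * hc'
    _ = p n x := by
      rw [sum_range_succ, sum_eq_zero fun k hk => ?_]
      · simp [hp]
      · rw [hp₀ _ (by have := mem_range.1 hk; omega), mul_zero]

end GoncarovRecurrence

section SetPartitions

variable {α : Type*} [DecidableEq α]

/-- The set partitions of `s`, each given by its finset of blocks. -/
noncomputable def setPartitions (s : Finset α) : Finset (Finset (Finset α)) :=
  univ.image fun π : Finpartition s => π.parts

theorem mem_setPartitions {s : Finset α} {P : Finset (Finset α)} :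
    P ∈ setPartitions s ↔
      ∅ ∉ P ∧ (∀ A ∈ P, ∀ B ∈ P, A ≠ B → Disjoint A B) ∧ P.biUnion id = s := by
  constructor
  · intro h
    obtain ⟨π, -, rfl⟩ := mem_image.1 h
    exact ⟨π.bot_notMem, fun A hA B hB h => π.disjoint hA hB h, π.biUnion_parts⟩
  · rintro ⟨h₁, h₂, h₃⟩
    refine mem_image.2 ⟨⟨P, ?_, by rw [← h₃, sup_eq_biUnion], h₁⟩, mem_univ _, rfl⟩
    exact supIndep_iff_pairwiseDisjoint.2 fun A hA B hB h => h₂ A hA B hB h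

theorem sum_finpartition {M : Type*} [AddCommMonoid M] (s : Finset α)
    (F : Finset (Finset α) → M) :
    ∑ π : Finpartition s, F π.parts = ∑ P ∈ setPartitions s, F P := by
  rw [setPartitions, sum_image fun π _ π' _ h => Finpartition.ext h]

/-- A partition of `s` with a chosen set of blocks is a subset `A` of `s` together with a
partition of `A` and a partition of its complement. -/
theorem sum_setPartitions_powerset {M : Type*} [AddCommMonoid M] (s : Finset α)
    (F : Finset (Finset α) → Finset (Finset α) → M) :
    ∑ P ∈ setPartitions s, ∑ T ∈ P.powerset, F T (P \ T) =
      ∑ A ∈ s.powerset, ∑ P ∈ setPartitions A, ∑ Q ∈ setPartitions (s \ A), F P Q := by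
  simp_rw [← sum_product']
  rw [sum_sigma', sum_sigma']
  have key : ∀ A P Q, A ⊆ s → P ∈ setPartitions A → Q ∈ setPartitions (s \ A) → Disjoint P Q := by
    intro A P Q _ hP hQ
    rw [mem_setPartitions] at hP hQ
    refine disjoint_left.2 fun B hB hB' => ?_
    obtain ⟨b, hb⟩ := nonempty_iff_ne_empty.2 fun h : B = ∅ => hP.1 (h ▸ hB)
    have h₁ : b ∈ A := hP.2.2 ▸ mem_biUnion.2 ⟨B, hB, hb⟩
    have h₂ : b ∈ s \ A := hQ.2.2 ▸ mem_biUnion.2 ⟨B, hB', hb⟩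
    exact (mem_sdiff.1 h₂).2 h₁
  refine sum_nbij' (fun X => ⟨X.2.biUnion id, X.2, X.1 \ X.2⟩) (fun X => ⟨X.2.1 ∪ X.2.2, X.2.1⟩)
    ?_ ?_ ?_ ?_ ?_
  · rintro ⟨P, T⟩ h
    simp only [mem_sigma, mem_powerset, mem_product, mem_setPartitions] at h ⊢
    obtain ⟨⟨h₁, h₂, rfl⟩, hT⟩ := h
    refine ⟨biUnion_subset_biUnion_of_subset_left _ hT,
      ⟨fun h => h₁ (hT h), fun A hA B hB => h₂ A (hT hA) B (hT hB), trivial⟩,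
      fun h => h₁ (mem_sdiff.1 h).1,
      fun A hA B hB => h₂ A (mem_sdiff.1 hA).1 B (mem_sdiff.1 hB).1, ?_⟩
    ext b
    simp only [mem_biUnion, mem_sdiff, id]
    constructor
    · rintro ⟨A, ⟨hA, hAT⟩, hb⟩
      refine ⟨⟨A, hA, hb⟩, ?_⟩
      rintro ⟨B, hB, hb'⟩
      have hne : A ≠ B := fun h => hAT (h ▸ hB)
      exact disjoint_left.1 (h₂ A hA B (hT hB) hne) hb hb'
    · rintro ⟨⟨A, hA, hb⟩, h⟩
      exact ⟨A, ⟨hA, fun hAT => h ⟨A, hAT, hb⟩⟩, hb⟩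
  · rintro ⟨A, P, Q⟩ h
    simp only [mem_sigma, mem_powerset, mem_product, mem_setPartitions] at h ⊢
    obtain ⟨hA, ⟨p₁, p₂, p₃⟩, q₁, q₂, q₃⟩ := h
    have hPQ : ∀ B ∈ P, ∀ C ∈ Q, Disjoint B C := fun B hB C hC => by
      have hB' : B ⊆ A := p₃ ▸ subset_biUnion_of_mem id hB
      have hC' : C ⊆ s \ A := q₃ ▸ subset_biUnion_of_mem id hC
      exact disjoint_of_subset_left hB' (disjoint_of_subset_right hC' disjoint_sdiff)
    refine ⟨⟨by simp [p₁, q₁], fun B hB C hC hne => ?_, ?_⟩, subset_union_left⟩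
    · rcases mem_union.1 hB with hB | hB <;> rcases mem_union.1 hC with hC | hC
      · exact p₂ B hB C hC hne
      · exact hPQ B hB C hC
      · exact (hPQ C hC B hB).symm
      · exact q₂ B hB C hC hne
    · rw [union_biUnion, p₃, q₃, union_sdiff_of_subset hA]
  · rintro ⟨P, T⟩ h
    simp only [mem_sigma, mem_powerset] at h
    simp [union_sdiff_of_subset h.2]
  · rintro ⟨A, P, Q⟩ h
    simp only [mem_sigma, mem_powerset, mem_product] at h
    have h₁ := key A P Q h.1 h.2.1 h.2.2
    have h₂ := (mem_setPartitions.1 h.2.1).2.2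
    simp [h₂, union_sdiff_cancel_left h₁]
  · rintro ⟨P, T⟩ _
    rfl

theorem sum_setPartitions_map {β M : Type*} [DecidableEq β] [AddCommMonoid M] (e : α ↪ β)
    (s : Finset α) (F : Finset (Finset β) → M) :
    ∑ P ∈ setPartitions (s.map e), F P =
      ∑ P ∈ setPartitions s, F (P.map (mapEmbedding e).toEmbedding) := by
  symm
  refine sum_nbij (fun P => P.map (mapEmbedding e).toEmbedding) ?_ ?_ ?_ fun _ _ => rfl
  · intro P hP
    obtain ⟨h₁, h₂, rfl⟩ := mem_setPartitions.1 hP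
    refine mem_setPartitions.2 ⟨by simpa using h₁, ?_, ?_⟩
    · simp only [mem_map, RelEmbedding.coe_toEmbedding, mapEmbedding_apply]
      rintro _ ⟨A, hA, rfl⟩ _ ⟨B, hB, rfl⟩ hne
      exact (disjoint_map e).2 (h₂ A hA B hB fun h => hne (h ▸ rfl))
    · ext b
      simp only [mem_biUnion, mem_map, RelEmbedding.coe_toEmbedding, mapEmbedding_apply, id]
      aesop
  · intro P _ Q _ h
    exact map_injective _ h
  · intro Q hQ
    obtain ⟨h₁, h₂, h₃⟩ := mem_setPartitions.1 hQ
    have hQs : ∀ B ∈ Q, ∃ A ⊆ s, A.map e = B := fun B hB => by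
      have hB' : B ⊆ s.map e := h₃ ▸ subset_biUnion_of_mem id hB
      obtain ⟨A, hA, rfl⟩ := subset_map_iff.1 hB'
      exact ⟨A, hA, rfl⟩
    have hQ' : (s.powerset.filter fun A => A.map e ∈ Q).map (mapEmbedding e).toEmbedding = Q := by
      ext B
      simp only [mem_map, mem_filter, mem_powerset, RelEmbedding.coe_toEmbedding,
        mapEmbedding_apply]
      constructor
      · rintro ⟨A, ⟨-, h⟩, rfl⟩
        exact h
      · intro hB
        obtain ⟨A, hA, rfl⟩ := hQs B hB
        exact ⟨A, ⟨hA, hB⟩, rfl⟩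
    refine ⟨s.powerset.filter fun A => A.map e ∈ Q, ?_, hQ'⟩
    refine mem_setPartitions.2 ⟨by simpa using h₁, ?_, ?_⟩
    · intro A hA B hB hne
      exact (disjoint_map e).1 (h₂ _ (mem_filter.1 hA).2 _ (mem_filter.1 hB).2
        fun h => hne (map_injective e h))
    · ext a
      simp only [mem_biUnion, mem_filter, mem_powerset, id]
      constructor
      · rintro ⟨A, ⟨hA, -⟩, ha⟩
        exact hA ha
      · intro ha
        have ha' : e a ∈ Q.biUnion id := h₃ ▸ mem_map_of_mem e ha
        obtain ⟨B, hB, hb⟩ := mem_biUnion.1 ha'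
        obtain ⟨A, hA, rfl⟩ := hQs B hB
        exact ⟨A, ⟨hA, hB⟩, (mem_map' e).1 hb⟩

end SetPartitions

section TypeEnumerator

variable {α : Type*} [DecidableEq α] {S : Type*} [CommRing S]

/-- The total weight of the hands on a given set of blocks. -/
def blockWeight (d : ℕ → ℕ) (y : ℕ → S) (P : Finset (Finset α)) : S :=
  ∏ B ∈ P, (d B.card : S) * y B.card

theorem blockWeight_mul_sdiff (d : ℕ → ℕ) (y : ℕ → S) {P T : Finset (Finset α)} (h : T ⊆ P) :
    blockWeight d y P = blockWeight d y T * blockWeight d y (P \ T) :=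
  (mul_comm _ _).trans (prod_sdiff h) |>.symm

theorem sum_setPartitions_eq_hEnum (d : ℕ → ℕ) (y : ℕ → S) (s : Finset α) (x : S) :
    ∑ P ∈ setPartitions s, blockWeight d y P * x ^ #P = hEnum d y #s x := by
  have h : hEnum d y #s x =
      ∑ P ∈ setPartitions (univ : Finset (Fin #s)), blockWeight d y P * x ^ #P := by
    rw [hEnum, ← sum_finpartition univ fun P => blockWeight d y P * x ^ #P]
    split_ifs with h
    · have : IsEmpty (Fin #s) := by rw [h]; infer_instance
      rw [sum_finpartition univ fun P => blockWeight d y P * x ^ #P]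
      have h₁ : setPartitions (univ : Finset (Fin #s)) = {∅} := by
        ext P
        rw [mem_setPartitions, mem_singleton]
        constructor
        · rintro ⟨h₁, -, -⟩
          refine eq_empty_of_forall_notMem fun B hB => h₁ ?_
          rwa [← eq_empty_of_isEmpty B]
        · rintro rfl
          simp [univ_eq_empty]
      rw [h₁]
      simp [blockWeight]
    · rfl
  let e : Fin #s ↪ α := s.equivFin.symm.toEmbedding.trans (Function.Embedding.subtype _)
  have he : univ.map e = s := by
    ext a
    simp only [mem_map, mem_univ, true_and, e, Function.Embedding.trans_apply,
      Equiv.coe_toEmbedding, Function.Embedding.subtype_apply]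
    exact ⟨fun ⟨i, hi⟩ => hi ▸ (s.equivFin.symm i).2,
      fun ha => ⟨s.equivFin ⟨a, ha⟩, by simp⟩⟩
  rw [h, ← sum_congr (congrArg setPartitions he) fun _ _ => rfl, sum_setPartitions_map]
  simp [blockWeight]

theorem hEnum_zero_left (d : ℕ → ℕ) (y : ℕ → S) (x : S) : hEnum d y 0 x = 1 := by
  simp [hEnum]

theorem hEnum_zero_right (d : ℕ → ℕ) (y : ℕ → S) {n : ℕ} (hn : n ≠ 0) : hEnum d y n (0 : S) = 0 := by
  rw [hEnum, if_neg hn]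
  refine sum_eq_zero fun π _ => ?_
  have : (univ : Finset (Fin n)) ≠ ⊥ := by
    have := Fin.pos_iff_nonempty.1 (Nat.pos_of_ne_zero hn)
    exact univ_nonempty.ne_empty
  rw [zero_pow (π.parts_nonempty this).card_ne_zero, mul_zero]

theorem hEnum_add (d : ℕ → ℕ) (y : ℕ → S) (n : ℕ) (u v : S) :
    hEnum d y n (u + v) =
      ∑ k ∈ range (n + 1), (n.choose k : S) * hEnum d y k u * hEnum d y (n - k) v := by
  have h := sum_setPartitions_eq_hEnum d y (univ : Finset (Fin n)) (u + v)
  rw [card_univ, Fintype.card_fin] at h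
  rw [← h]
  calc
    _ = ∑ P ∈ setPartitions univ, ∑ T ∈ P.powerset,
          (blockWeight d y T * u ^ #T) * (blockWeight d y (P \ T) * v ^ #(P \ T)) := by
      refine sum_congr rfl fun P _ => ?_
      rw [← sum_pow_mul_eq_add_pow, mul_sum]
      refine sum_congr rfl fun T hT => ?_
      rw [mem_powerset] at hT
      rw [blockWeight_mul_sdiff d y hT, card_sdiff_of_subset hT]
      ring
    _ = ∑ A ∈ (univ : Finset (Fin n)).powerset, hEnum d y #A u * hEnum d y (n - #A) v := by
      rw [sum_setPartitions_powerset univ fun P Q =>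
        (blockWeight d y P * u ^ #P) * (blockWeight d y Q * v ^ #Q)]
      refine sum_congr rfl fun A _ => ?_
      simp_rw [← mul_sum, ← sum_mul]
      rw [sum_setPartitions_eq_hEnum, sum_setPartitions_eq_hEnum,
        card_sdiff_of_subset (subset_univ A), card_univ, Fintype.card_fin]
    _ = _ := by
      rw [sum_powerset_apply_card fun k => hEnum d y k u * hEnum d y (n - k) v]
      simp [mul_assoc]

end TypeEnumerator

section ParkingLabelings

variable {β : Type*}

theorem exists_parking_subset (c : β → ℕ) {z : ℕ → ℕ} (hz : Monotone z) (T : Finset β)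
    (g : β → ℕ) :
    ∃ U ⊆ T, (∀ j < ∑ b ∈ U, c b, j + 1 ≤ ∑ b ∈ U with g b ≤ z j, c b) ∧
      ∀ b ∈ T, b ∉ U → z (∑ b ∈ U, c b) < g b := by
  have hex : ∃ i, ∑ b ∈ T with g b ≤ z i, c b ≤ i :=
    ⟨∑ b ∈ T, c b, sum_le_sum_of_subset (filter_subset _ _)⟩
  set i := Nat.find hex
  have hlt : ∀ j < i, j + 1 ≤ ∑ b ∈ T with g b ≤ z j, c b := fun j hj =>
    not_le.1 (Nat.find_min hex hj)
  have hsum : ∑ b ∈ T with g b ≤ z i, c b = i := by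
    refine le_antisymm (Nat.find_spec hex) ?_
    rcases Nat.eq_zero_or_pos i with h | h
    · omega
    · have h₁ := hlt (i - 1) (by omega)
      have h₂ : ∑ b ∈ T with g b ≤ z (i - 1), c b ≤ ∑ b ∈ T with g b ≤ z i, c b :=
        sum_le_sum_of_subset (monotone_filter_right T fun b _ hb => hb.trans (hz (Nat.sub_le i 1)))
      omega
  refine ⟨{b ∈ T | g b ≤ z i}, filter_subset _ _, fun j hj => ?_, fun b hb hb' => ?_⟩
  · rw [hsum] at hj
    rw [filter_filter, filter_congr fun b _ => and_iff_right_of_imp fun h => h.trans (hz hj.le)]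
    exact hlt j hj
  · rw [hsum]
    exact not_le.1 fun h => hb' (mem_filter.2 ⟨hb, h⟩)

theorem le_of_parking {c : β → ℕ} {z : ℕ → ℕ} (hz : Monotone z) {U : Finset β}
    (hc : ∀ b ∈ U, 0 < c b) {g : β → ℕ}
    (hU : ∀ j < ∑ b ∈ U, c b, j + 1 ≤ ∑ b ∈ U with g b ≤ z j, c b) {b : β} (hb : b ∈ U) :
    g b ≤ z (∑ b ∈ U, c b) := by
  by_contra h
  have hpos : 0 < ∑ b ∈ U, c b := sum_pos hc ⟨b, hb⟩
  have h₁ := hU (∑ b ∈ U, c b - 1) (by omega)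
  have h₂ : ∑ a ∈ U with g a ≤ z (∑ b ∈ U, c b - 1), c a < ∑ a ∈ U, c a :=
    sum_lt_sum_of_subset (filter_subset _ _) hb
      (fun hb' => h ((mem_filter.1 hb').2.trans (hz (Nat.sub_le _ 1)))) (hc b hb)
      fun _ _ _ => Nat.zero_le _
  omega

theorem parking_subset_unique {c : β → ℕ} {z : ℕ → ℕ} (hz : Monotone z) {T : Finset β}
    (hc : ∀ b ∈ T, 0 < c b) {g : β → ℕ} {U V : Finset β} (hUT : U ⊆ T) (hVT : V ⊆ T)
    (hU : ∀ j < ∑ b ∈ U, c b, j + 1 ≤ ∑ b ∈ U with g b ≤ z j, c b)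
    (hU' : ∀ b ∈ T, b ∉ U → z (∑ b ∈ U, c b) < g b)
    (hV : ∀ j < ∑ b ∈ V, c b, j + 1 ≤ ∑ b ∈ V with g b ≤ z j, c b)
    (hV' : ∀ b ∈ T, b ∉ V → z (∑ b ∈ V, c b) < g b) : U = V := by
  have hle : ∀ {U V : Finset β}, V ⊆ T → (∀ b ∈ T, b ∉ U → z (∑ b ∈ U, c b) < g b) →
      (∀ j < ∑ b ∈ V, c b, j + 1 ≤ ∑ b ∈ V with g b ≤ z j, c b) →
      ∑ b ∈ V, c b ≤ ∑ b ∈ U, c b := by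
    intro U V hVT hU' hV
    by_contra! h
    have h₁ := hV _ h
    have h₂ : ∑ b ∈ V with g b ≤ z (∑ b ∈ U, c b), c b ≤ ∑ b ∈ U, c b := by
      refine sum_le_sum_of_subset fun b hb => ?_
      rw [mem_filter] at hb
      by_contra hbU
      exact absurd hb.2 (not_le.2 (hU' b (hVT hb.1) hbU))
    omega
  have heq : ∑ b ∈ U, c b = ∑ b ∈ V, c b := le_antisymm (hle hUT hV' hU) (hle hVT hU' hV)
  ext b
  constructor
  · intro hb
    by_contra hbV
    have := le_of_parking hz (fun b hb => hc b (hUT hb)) hU hb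
    have := hV' b (hUT hb) hbV
    rw [heq] at *
    omega
  · intro hb
    by_contra hbU
    have := le_of_parking hz (fun b hb => hc b (hVT hb)) hV hb
    have := hU' b (hVT hb) hbU
    rw [heq] at *
    omega

variable [Fintype β] [DecidableEq β]

/-- The functions on `T` with values in `{l + 1, …, N}`, extended by zero. -/
def boxLabelings (N l : ℕ) (T : Finset β) : Finset (β → ℕ) :=
  Fintype.piFinset fun b => if b ∈ T then Ioc l N else {0}

theorem mem_boxLabelings {N l : ℕ} {T : Finset β} {g : β → ℕ} :
    g ∈ boxLabelings N l T ↔ (∀ b ∈ T, l < g b ∧ g b ≤ N) ∧ ∀ b ∉ T, g b = 0 := by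
  simp only [boxLabelings, Fintype.mem_piFinset]
  constructor
  · intro h
    exact ⟨fun b hb => by simpa [hb] using h b, fun b hb => by simpa [hb] using h b⟩
  · rintro ⟨h₁, h₂⟩ b
    split_ifs with hb
    · exact mem_Ioc.2 (h₁ b hb)
    · exact mem_singleton.2 (h₂ b hb)

theorem card_boxLabelings (N l : ℕ) (T : Finset β) : #(boxLabelings N l T) = (N - l) ^ #T := by
  rw [boxLabelings, Fintype.card_piFinset]
  simp [apply_ite card]

/-- The labelings of `T` by `{1, …, N}` that are parking functions when each `b ∈ T` is
repeated `c b` times. -/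
def parkingLabelings (c : β → ℕ) (z : ℕ → ℕ) (N : ℕ) (T : Finset β) : Finset (β → ℕ) :=
  {g ∈ boxLabelings N 0 T | ∀ j < ∑ b ∈ T, c b, j + 1 ≤ ∑ b ∈ T with g b ≤ z j, c b}

theorem card_labelings_parking_subset (c : β → ℕ) (z : ℕ → ℕ) (N : ℕ) {T U : Finset β}
    (hUT : U ⊆ T) :
    #{g ∈ boxLabelings N 0 T | (∀ j < ∑ b ∈ U, c b, j + 1 ≤ ∑ b ∈ U with g b ≤ z j, c b) ∧
        ∀ b ∈ T, b ∉ U → z (∑ b ∈ U, c b) < g b} =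
      #(parkingLabelings c z N U) * (N - z (∑ b ∈ U, c b)) ^ #(T \ U) := by
  rw [← card_boxLabelings, ← card_product]
  refine card_nbij' (fun g => (fun b => if b ∈ U then g b else 0, fun b => if b ∈ U then 0 else g b))
    (fun p b => if b ∈ U then p.1 b else p.2 b) ?_ ?_ ?_ ?_
  · intro g hg
    obtain ⟨h₁, h₂, h₃⟩ := mem_filter.1 hg
    rw [mem_boxLabelings] at h₁
    refine mem_product.2 ⟨mem_filter.2 ⟨mem_boxLabelings.2 ⟨fun b hb => ?_, fun b hb => ?_⟩,
      fun j hj => ?_⟩, mem_boxLabelings.2 ⟨fun b hb => ?_, fun b hb => ?_⟩⟩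
    · simpa [hb] using h₁.1 b (hUT hb)
    · simp [hb]
    · refine (h₂ j hj).trans_eq (sum_congr (filter_congr fun b hb => by simp [hb]) fun _ _ => rfl)
    · rw [mem_sdiff] at hb
      simpa [hb.2] using ⟨h₃ b hb.1 hb.2, (h₁.1 b hb.1).2⟩
    · by_cases hbU : b ∈ U
      · simp [hbU]
      · simpa [hbU] using h₁.2 b fun hbT => hb (mem_sdiff.2 ⟨hbT, hbU⟩)
  · rintro ⟨p, q⟩ hpq
    obtain ⟨hp, hq⟩ := mem_product.1 hpq
    obtain ⟨hp, hp'⟩ := mem_filter.1 hp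
    rw [mem_boxLabelings] at hp hq
    dsimp only at hp hp' hq
    refine mem_filter.2 ⟨mem_boxLabelings.2 ⟨fun b hb => ?_, fun b hb => ?_⟩, fun j hj => ?_,
      fun b hb hbU => ?_⟩
    · by_cases hbU : b ∈ U
      · simpa [hbU] using hp.1 b hbU
      · have := hq.1 b (mem_sdiff.2 ⟨hb, hbU⟩)
        simp only [hbU, if_false]
        omega
    · have hbU : b ∉ U := fun h => hb (hUT h)
      simpa [hbU] using hq.2 b fun h => hb (mem_sdiff.1 h).1
    · exact (hp' j hj).trans_eq
        (sum_congr (filter_congr fun b hb => by simp [hb]) fun _ _ => rfl)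
    · simpa [hbU] using (hq.1 b (mem_sdiff.2 ⟨hb, hbU⟩)).1
  · intro g _
    ext b
    by_cases hb : b ∈ U <;> simp [hb]
  · rintro ⟨p, q⟩ hpq
    obtain ⟨hp, hq⟩ := mem_product.1 hpq
    have hp := (mem_boxLabelings.1 (mem_filter.1 hp).1).2
    have hq := (mem_boxLabelings.1 hq).2
    dsimp only at hp hq
    refine Prod.ext (funext fun b => ?_) (funext fun b => ?_)
    · by_cases hb : b ∈ U
      · simp [hb]
      · simp [hb, hp b hb]
    · by_cases hb : b ∈ U
      · simp [hb, hq b fun h => (mem_sdiff.1 h).2 hb]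
      · simp [hb]

/-- Every labeling decomposes uniquely into a maximal parking labeling and a remainder. -/
theorem pow_card_eq_sum_parkingLabelings {c : β → ℕ} {z : ℕ → ℕ} (hz : Monotone z) (N : ℕ)
    {T : Finset β} (hc : ∀ b ∈ T, 0 < c b) :
    N ^ #T = ∑ U ∈ T.powerset,
      #(parkingLabelings c z N U) * (N - z (∑ b ∈ U, c b)) ^ #(T \ U) := by
  choose φ hφ₁ hφ₂ hφ₃ using exists_parking_subset c hz T
  rw [← tsub_zero N, ← card_boxLabelings, tsub_zero,
    card_eq_sum_card_fiberwise (f := φ) (t := T.powerset) fun g _ => mem_powerset.2 (hφ₁ g)]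
  refine sum_congr rfl fun U hU => ?_
  have hU := mem_powerset.1 hU
  rw [← card_labelings_parking_subset c z N hU]
  congr 1
  refine filter_congr fun g _ => ⟨?_, fun h => ?_⟩
  · rintro rfl
    exact ⟨hφ₂ g, hφ₃ g⟩
  · exact parking_subset_unique hz hc (hφ₁ g) hU (hφ₂ g) (hφ₃ g) h.1 h.2

end ParkingLabelings

section ParkingEnumerator

variable {n : ℕ} {S : Type*} [CommRing S]

/-- The sum over partitions `P` of `A` of the weight of `P` times its number of parking
labelings by `{1, …, N}`. -/
noncomputable def parkingEnum (d : ℕ → ℕ) (y : ℕ → S) (z : ℕ → ℕ) (N : ℕ)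
    (A : Finset (Fin n)) : S :=
  ∑ P ∈ setPartitions A, blockWeight d y P * (#(parkingLabelings card z N P) : S)

theorem sum_card_of_mem_setPartitions {A : Finset (Fin n)} {P : Finset (Finset (Fin n))}
    (hP : P ∈ setPartitions A) : ∑ B ∈ P, #B = #A := by
  obtain ⟨-, h₂, rfl⟩ := mem_setPartitions.1 hP
  exact (card_biUnion fun A hA B hB => h₂ A hA B hB).symm

theorem hEnum_eq_sum_parkingEnum (d : ℕ → ℕ) (y : ℕ → S) {z : ℕ → ℕ} (hz : Monotone z) {N : ℕ}
    (hN : ∀ i, z i ≤ N) (A : Finset (Fin n)) :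
    hEnum d y #A (N : S) = ∑ B ∈ A.powerset,
      parkingEnum d y z N B * hEnum d y (#A - #B) ((N : S) - z #B) := by
  let F (P Q : Finset (Finset (Fin n))) : S :=
    (blockWeight d y P * (#(parkingLabelings card z N P) : S)) *
      (blockWeight d y Q * ((N : S) - z (∑ B ∈ P, #B)) ^ #Q)
  calc
    _ = ∑ P ∈ setPartitions A, ∑ T ∈ P.powerset, F T (P \ T) := by
      rw [← sum_setPartitions_eq_hEnum]
      refine sum_congr rfl fun P hP => ?_
      have hP' : ∀ B ∈ P, 0 < #B := fun B hB => card_pos.2 <| nonempty_iff_ne_empty.2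
        fun h => (mem_setPartitions.1 hP).1 (h ▸ hB)
      rw [← Nat.cast_pow, pow_card_eq_sum_parkingLabelings hz N hP', Nat.cast_sum, mul_sum]
      refine sum_congr rfl fun T hT => ?_
      rw [blockWeight_mul_sdiff d y (mem_powerset.1 hT), Nat.cast_mul, Nat.cast_pow,
        Nat.cast_sub (hN _)]
      ring
    _ = _ := by
      rw [sum_setPartitions_powerset A F]
      refine sum_congr rfl fun B hB => ?_
      rw [parkingEnum, sum_mul]
      refine sum_congr rfl fun P hP => ?_
      rw [← card_sdiff_of_subset (mem_powerset.1 hB), ← sum_setPartitions_eq_hEnum, mul_sum,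
        ← sum_card_of_mem_setPartitions hP]

theorem parkingEnum_eq_gonc (d : ℕ → ℕ) (y : ℕ → S) {z : ℕ → ℕ} (hz : Monotone z) {N : ℕ}
    (hN : ∀ i, z i ≤ N) (A : Finset (Fin n)) :
    parkingEnum d y z N A = gonc (hEnum d y) (fun i => (N : S) - z i) #A N := by
  induction A using Finset.strongInduction with
  | _ A ih =>
    set t := fun k => gonc (hEnum d y) (fun i => (N : S) - z i) k N
    have h₁ := hEnum_eq_sum_parkingEnum d y hz hN A
    have h₂ : hEnum d y #A (N : S) =
        ∑ B ∈ A.powerset, t #B * hEnum d y (#A - #B) ((N : S) - z #B) := by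
      rw [sum_powerset_apply_card fun k => t k * hEnum d y (#A - k) ((N : S) - z k),
        ← sum_choose_mul_gonc (hEnum_zero_left d y) (fun i => (N : S) - z i) #A N]
      refine sum_congr rfl fun i _ => ?_
      rw [nsmul_eq_mul]
      ring
    have hA := mem_powerset_self A
    rw [h₁, ← add_sum_erase _ _ hA, ← add_sum_erase _ _ hA] at h₂
    rw [sum_congr rfl fun B hB => ?_] at h₂
    · simpa [hEnum_zero_left] using add_right_cancel h₂
    · rw [mem_erase, mem_powerset] at hB
      rw [ih B (hB.2.ssubset_of_ne hB.1)]

theorem PFcount_eq_card_parkingLabelings (π : Finpartition (univ : Finset (Fin n))) {z : ℕ → ℕ}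
    {N : ℕ} (hN : ∀ i, z i ≤ N) : PFcount π z = #(parkingLabelings card z N π.parts) := by
  have hsum : ∑ B ∈ π.parts, #B = n := by simpa using π.sum_card_parts
  have hpart : ∀ j, π.part j ∈ π.parts := fun j => π.part_mem.2 (mem_univ j)
  have hmem : ∀ j, j ∈ π.part j := fun j => π.mem_part (mem_univ j)
  have hcount : ∀ (g : Finset (Fin n) → ℕ) (m : ℕ),
      #{j | g (π.part j) ≤ m} = ∑ B ∈ π.parts with g B ≤ m, #B := by
    intro g m
    refine Eq.trans ?_ (card_biUnion (t := id) fun A hA B hB =>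
      π.disjoint (mem_filter.1 hA).1 (mem_filter.1 hB).1)
    congr 1
    ext j
    simp only [mem_filter, mem_univ, true_and, mem_biUnion]
    constructor
    · exact fun h => ⟨π.part j, ⟨hpart j, h⟩, hmem j⟩
    · rintro ⟨B, ⟨hB, h⟩, hj⟩
      rwa [π.part_eq_of_mem hB hj]
  have hiff : ∀ g : Finset (Fin n) → ℕ, IsParking z (fun j => g (π.part j)) ↔
      (∀ j, 1 ≤ g (π.part j)) ∧ ∀ i < n, i + 1 ≤ ∑ B ∈ π.parts with g B ≤ z i, #B := by
    intro g
    simp only [IsParking, hcount]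
    exact and_congr_right fun _ => ⟨fun h i hi => h ⟨i, hi⟩, fun h i => h i i.2⟩
  rw [PFcount, ← Nat.card_eq_finsetCard]
  symm
  refine Nat.card_eq_of_bijective (fun g => ⟨fun j => g.1 (π.part j), ?_, ?_⟩) ⟨?_, ?_⟩
  · intro B hB i hi j hj
    simp only [π.part_eq_of_mem hB hi, π.part_eq_of_mem hB hj]
  · obtain ⟨h₁, h₂⟩ := mem_filter.1 g.2
    rw [hsum] at h₂
    exact (hiff g.1).2 ⟨fun j => ((mem_boxLabelings.1 h₁).1 _ (hpart j)).1, h₂⟩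
  · rintro ⟨g, hg⟩ ⟨g', hg'⟩ h
    have hg := (mem_boxLabelings.1 (mem_filter.1 hg).1).2
    have hg' := (mem_boxLabelings.1 (mem_filter.1 hg').1).2
    refine Subtype.ext (funext fun B => ?_)
    by_cases hB : B ∈ π.parts
    · obtain ⟨j, hj⟩ := π.nonempty_of_mem_parts hB
      have := congrFun (congrArg Subtype.val h) j
      simpa only [π.part_eq_of_mem hB hj] using this
    · exact (hg B hB).trans (hg' B hB).symm
  · rintro ⟨f, hf, hpark⟩
    let g : Finset (Fin n) → ℕ := fun B => if B ∈ π.parts then B.sup f else 0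
    have hgf : (fun j => g (π.part j)) = f := by
      funext j
      simp only [g, hpart j, if_true]
      exact le_antisymm (Finset.sup_le fun i hi => (hf _ (hpart j) i hi j (hmem j)).le)
        (le_sup (hmem j))
    have hfN : ∀ j, f j ≤ N := by
      intro j
      have hn : n - 1 < n := by have := j.2; omega
      have h₁ := hpark.2 ⟨n - 1, hn⟩
      have h₂ : ({j | f j ≤ z (n - 1)} : Finset (Fin n)) = univ := by
        rw [← card_eq_iff_eq_univ, Fintype.card_fin]
        refine le_antisymm (card_finset_fin_le _) ?_
        simp only at h₁
        omega
      exact (mem_filter.1 (h₂ ▸ mem_univ j)).2.trans (hN _)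
    have hg := (hiff g).1 (hgf.symm ▸ hpark)
    refine ⟨⟨g, mem_filter.2 ⟨mem_boxLabelings.2 ⟨fun B hB => ?_, fun B hB => ?_⟩, ?_⟩⟩,
      Subtype.ext hgf⟩
    · obtain ⟨j, hj⟩ := π.nonempty_of_mem_parts hB
      rw [← π.part_eq_of_mem hB hj]
      exact ⟨hg.1 j, (congrFun hgf j).trans_le (hfN j)⟩
    · simp [g, hB]
    · rw [hsum]
      exact hg.2

theorem PFcount_congr (π : Finpartition (univ : Finset (Fin n))) {z z' : ℕ → ℕ}
    (h : ∀ i < n, z i = z' i) : PFcount π z = PFcount π z' := by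
  have : ∀ f : Fin n → ℕ, IsParking z f ↔ IsParking z' f := fun f =>
    and_congr_right fun _ => forall_congr' fun i => by rw [h i i.2]
  simp only [PFcount, this]

end ParkingEnumerator

/-- Theorem 4.4: for the Gončarov polynomials attached to the type enumerators
`h_n(·; y)` of an exponential family with deck sizes `d`, and positive integers
`z_0 ≤ ⋯ ≤ z_{n-1} < x`,
`t_n(0; y, F, -Z) = t_n(x; y, F, x-Z) = ∑_{π ∈ Π_n} (∏_B d_{|B|} y_{|B|}) PF_π(Z)`,
the sum over hands `H` of weight `n` of `type(H)` times the number of card-labelings of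
`H` that are `z⃗`-parking functions. -/
theorem goncarov_exponential_family (d : ℕ → ℕ) (y : ℕ → R) (n : ℕ) (z : ℕ → ℕ)
    (hpos : ∀ i < n, 0 < z i) (hmono : ∀ i j, i ≤ j → j < n → z i ≤ z j)
    (x : ℤ) (hx : ∀ i < n, (z i : ℤ) < x) :
    gonc (hEnum d y) (fun i => -(z i : R)) n (0 : R)
        = gonc (hEnum d y) (fun i => (x : R) - (z i : R)) n (x : R) ∧
    gonc (hEnum d y) (fun i => -(z i : R)) n (0 : R)
        = ∑ π : Finpartition (univ : Finset (Fin n)),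
            (∏ B ∈ π.parts, (d B.card : R) * y B.card) * (PFcount π z : R) := by
  have htrans : ∀ (z : ℕ → ℕ) (u : R), gonc (hEnum d y) (fun i => -(z i : R)) n (0 : R) =
      gonc (hEnum d y) (fun i => u - (z i : R)) n u := fun z u =>
    gonc_zero_neg_eq_gonc_sub (hEnum_zero_left d y) (fun _ => hEnum_zero_right d y)
      (hEnum_add d y) (fun i => (z i : R)) u n
  refine ⟨htrans z x, ?_⟩
  -- Only the first `n` entries of the grid matter, so it may be taken monotone and bounded.
  obtain ⟨z', N, hzz', hz', hN⟩ :
      ∃ (z' : ℕ → ℕ) (N : ℕ), (∀ i < n, z i = z' i) ∧ Monotone z' ∧ ∀ i, z' i ≤ N := by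
    rcases Nat.eq_zero_or_pos n with rfl | hn
    · exact ⟨0, 0, fun i hi => absurd hi (Nat.not_lt_zero i), monotone_const, fun _ => le_rfl⟩
    · exact ⟨fun i => z (min i (n - 1)), z (n - 1), fun i hi => congrArg z (by omega),
        fun i j hij => hmono _ _ (by omega) (by omega),
        fun i => hmono _ _ (by omega) (by omega)⟩
  rw [gonc_congr (Z' := fun i => -(z' i : R)) _ _ fun i hi => by rw [hzz' i hi], htrans z' N]
  have h := parkingEnum_eq_gonc d y hz' hN (univ : Finset (Fin n))
  rw [card_univ, Fintype.card_fin] at h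
  rw [← h, parkingEnum, ← sum_finpartition univ fun P =>
    blockWeight d y P * (#(parkingLabelings card z' N P) : R)]
  refine sum_congr rfl fun π _ => ?_
  rw [PFcount_congr π hzz', PFcount_eq_card_parkingLabelings π hN, blockWeight]
end
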